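/- Let n = 2^ℓ, m = 5ℓ, and suppose h_1,...,h_n, h'_1,...,h'_n, e ∈ CL_m satisfy h_j h'_j = e and h_j h'_k = 0 for j ≠ k. Given A ∈ M_n(ℝ), define B ∈ M_{2n}(CL_m) by: for odd i, B(i,j) = A((i+1)/2, j)·h_j if j ≤ n and 0 otherwise; for even i, B(i,j) = h'_{j-n} if j > n and 0 otherwise. Then the Cayley determinant Cdet_{2n}(B) = Σ_{σ∈S_{2n}} sgn(σ) B(1,σ(1))···B(2n,σ(2n)) equals sgn(ρ(1_n)) · perm_n(A) · e, where perm_n(A) is the (commutative) permanent of A. -/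

import Mathlib

/-- Clifford multiplication on the concrete model of `CL'_m`:
`e_S e_T = (-1)^{#{(s,t) ∈ S×T : s > t}} e_{S ∆ T}`. -/
noncomputable def clMul {m : ℕ} (f g : Finset (Fin m) → ℝ) : Finset (Fin m) → ℝ :=
  fun U => ∑ S : Finset (Fin m), ∑ T : Finset (Fin m),
    if symmDiff S T = U then
      (-1 : ℝ) ^ (((S ×ˢ T).filter fun p => p.2 < p.1).card) * f S * g T
    else 0

/-- The multiplicative unit `e_∅` of the Clifford algebra. -/
noncomputable def clOne {m : ℕ} : Finset (Fin m) → ℝ := fun S => if S = ∅ then 1 else 0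

/-- `σ ∈ S_{2n}` is the interleaving `ρ(π)` of `π ∈ S_n`. -/
def Interleaves (n : ℕ) (π : Equiv.Perm (Fin n)) (σ : Equiv.Perm (Fin (2 * n))) : Prop :=
  ∀ i : Fin n,
    σ ⟨2 * i.val, by have := i.isLt; omega⟩ =
      ⟨(π i).val, by have := (π i).isLt; omega⟩ ∧
    σ ⟨2 * i.val + 1, by have := i.isLt; omega⟩ =
      ⟨n + (π i).val, by have := (π i).isLt; omega⟩

/-- The sign relating `e_S e_T` to `e_{S ∆ T}`. -/
noncomputable def clSign {m : ℕ} (S T : Finset (Fin m)) : ℝ :=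
  ∏ s ∈ S, ∏ t ∈ T, if t < s then -1 else 1

lemma neg_one_pow_card_eq_clSign {m : ℕ} (S T : Finset (Fin m)) :
    (-1 : ℝ) ^ (((S ×ˢ T).filter fun p => p.2 < p.1).card) = clSign S T := by
  rw [clSign, ← Finset.prod_product', ← Finset.prod_const, Finset.prod_filter]

/-- A product of signs over a symmetric difference splits. -/
lemma Finset.prod_symmDiff_of_mul_self {α : Type*} [DecidableEq α] (f : α → ℝ)
    (hf : ∀ a, f a * f a = 1) (S T : Finset α) :
    ∏ a ∈ symmDiff S T, f a = (∏ a ∈ S, f a) * ∏ a ∈ T, f a := by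
  have hI : (∏ a ∈ S ∩ T, f a) * ∏ a ∈ S ∩ T, f a = 1 := by
    rw [← Finset.prod_mul_distrib]
    exact Finset.prod_eq_one fun a _ => hf a
  have hS := Finset.prod_inter_mul_prod_sdiff S T f
  have hT := Finset.prod_inter_mul_prod_sdiff T S f
  rw [Finset.inter_comm] at hT
  have hD : Disjoint (S \ T) (T \ S) := disjoint_sdiff_sdiff
  rw [symmDiff_def, Finset.sup_eq_union, Finset.prod_union hD, ← hS, ← hT]
  linear_combination (-(∏ a ∈ S \ T, f a) * ∏ a ∈ T \ S, f a) * hI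

lemma clSign_symmDiff_left {m : ℕ} (S T U : Finset (Fin m)) :
    clSign (symmDiff S T) U = clSign S U * clSign T U := by
  refine Finset.prod_symmDiff_of_mul_self _ (fun s => ?_) S T
  rw [← Finset.prod_mul_distrib]
  exact Finset.prod_eq_one fun t _ => by split_ifs <;> norm_num

lemma clSign_symmDiff_right {m : ℕ} (S T U : Finset (Fin m)) :
    clSign S (symmDiff T U) = clSign S T * clSign S U := by
  simp only [clSign]
  rw [← Finset.prod_mul_distrib]
  refine Finset.prod_congr rfl fun s _ => Finset.prod_symmDiff_of_mul_self _ (fun t => ?_) T U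
  split_ifs <;> norm_num

lemma clMul_apply {m : ℕ} (f g : Finset (Fin m) → ℝ) (U : Finset (Fin m)) :
    clMul f g U = ∑ S, clSign S (symmDiff S U) * f S * g (symmDiff S U) := by
  unfold clMul
  refine Finset.sum_congr rfl fun S _ => ?_
  rw [Finset.sum_eq_single (symmDiff S U)]
  · rw [if_pos (symmDiff_symmDiff_cancel_left S U), neg_one_pow_card_eq_clSign]
  · rintro T - hT
    refine if_neg fun hTU => hT ?_
    rw [← hTU, symmDiff_symmDiff_cancel_left]
  · simp

lemma clMul_assoc {m : ℕ} (f g k : Finset (Fin m) → ℝ) :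
    clMul (clMul f g) k = clMul f (clMul g k) := by
  ext U
  simp only [clMul_apply, Finset.mul_sum, Finset.sum_mul]
  rw [Finset.sum_comm]
  refine Finset.sum_congr rfl fun T _ => ?_
  refine Fintype.sum_equiv (Function.Involutive.toPerm (symmDiff T)
    (symmDiff_symmDiff_cancel_left T)) _ _ fun S => ?_
  have hU : symmDiff (symmDiff T S) (symmDiff T U) = symmDiff S U := by
    rw [symmDiff_comm T S, symmDiff_assoc, symmDiff_symmDiff_cancel_left]
  have hT : symmDiff T U = symmDiff (symmDiff T S) (symmDiff S U) := by
    rw [symmDiff_assoc, symmDiff_symmDiff_cancel_left]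
  have hS : clSign S (symmDiff S U) =
      clSign T (symmDiff S U) * clSign (symmDiff T S) (symmDiff S U) := by
    rw [← clSign_symmDiff_left, symmDiff_symmDiff_cancel_left]
  change _ = clSign T (symmDiff T U) * f T *
    (clSign (symmDiff T S) (symmDiff (symmDiff T S) (symmDiff T U)) * g (symmDiff T S) *
      k (symmDiff (symmDiff T S) (symmDiff T U)))
  rw [hU, hT, clSign_symmDiff_right T (symmDiff T S), hS]
  ring

lemma clMul_smul {m : ℕ} (r : ℝ) (f g : Finset (Fin m) → ℝ) :
    clMul f (r • g) = r • clMul f g := by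
  ext U
  simp only [clMul_apply, Pi.smul_apply, smul_eq_mul, Finset.mul_sum]
  exact Finset.sum_congr rfl fun S _ => by ring

lemma smul_clMul {m : ℕ} (r : ℝ) (f g : Finset (Fin m) → ℝ) :
    clMul (r • f) g = r • clMul f g := by
  ext U
  simp only [clMul_apply, Pi.smul_apply, smul_eq_mul, Finset.mul_sum]
  exact Finset.sum_congr rfl fun S _ => by ring

lemma clMul_zero {m : ℕ} (f : Finset (Fin m) → ℝ) : clMul f 0 = 0 := by
  ext U
  simp [clMul_apply]

lemma zero_clMul {m : ℕ} (f : Finset (Fin m) → ℝ) : clMul 0 f = 0 := by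
  ext U
  simp [clMul_apply]

lemma clMul_clOne {m : ℕ} (f : Finset (Fin m) → ℝ) : clMul f clOne = f := by
  ext U
  rw [clMul_apply, Finset.sum_eq_single U]
  · simp [clOne, clSign]
  · rintro S - hS
    have : symmDiff S U ≠ ∅ := fun h => hS (symmDiff_eq_bot.mp h)
    simp [clOne, this]
  · simp

lemma foldr_clMul_eq_zero {m : ℕ} {L : List (Finset (Fin m) → ℝ)} (hL : 0 ∈ L) :
    L.foldr clMul clOne = 0 := by
  induction L with
  | nil => simp at hL
  | cons a L ih =>
    rcases List.mem_cons.mp hL with rfl | hL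
    · exact zero_clMul _
    · rw [List.foldr_cons, ih hL, clMul_zero]

lemma foldr_clMul_smul_idempotent {m : ℕ} {e : Finset (Fin m) → ℝ} (he : clMul e e = e)
    (r : ℝ) (L : List ℝ) :
    ((r :: L).map (· • e)).foldr clMul clOne = (r :: L).prod • e := by
  induction L generalizing r with
  | nil => simp [clMul_clOne]
  | cons s L ih =>
    rw [List.map_cons, List.foldr_cons, ih, clMul_smul, smul_clMul, he, smul_smul,
      List.prod_cons (a := r), mul_comm]

/-- Associativity lets one multiply consecutive pairs of factors first. -/
lemma foldr_clMul_ofFn_two_mul {m n : ℕ} (F : Fin (2 * n) → Finset (Fin m) → ℝ) :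
    (List.ofFn F).foldr clMul clOne =
      (List.ofFn fun i : Fin n =>
        clMul (F ⟨2 * i.val, by omega⟩) (F ⟨2 * i.val + 1, by omega⟩)).foldr clMul clOne := by
  rw [List.ofFn_mul', List.foldr_flatten]
  have key : ∀ L : List (Fin n),
      (L.map fun i : Fin n => List.ofFn fun j : Fin 2 =>
        F ⟨2 * i.val + j.val, by omega⟩).foldr
          (fun l b => l.foldr clMul b) clOne =
      (L.map fun i : Fin n =>
        clMul (F ⟨2 * i.val, by omega⟩) (F ⟨2 * i.val + 1, by omega⟩)).foldr clMul clOne := by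
    intro L
    induction L with
    | nil => rfl
    | cons i L ih =>
      rw [List.map_cons, List.foldr_cons, ih, List.map_cons, List.foldr_cons, clMul_assoc]
      simp [List.ofFn_succ]
  rw [List.ofFn_eq_map, List.ofFn_eq_map (n := n)]
  exact key _

/-- Applying `π` to both halves of `Fin (2 * n)`. -/
def doublePerm {n : ℕ} (π : Equiv.Perm (Fin n)) : Equiv.Perm (Fin (2 * n)) :=
  (finSumFinEquiv.trans (finCongr (two_mul n).symm)).permCongr (Equiv.sumCongr π π)

lemma sign_doublePerm {n : ℕ} (π : Equiv.Perm (Fin n)) :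
    Equiv.Perm.sign (doublePerm π) = 1 := by
  rw [doublePerm, Equiv.Perm.sign_permCongr]
  exact (Equiv.Perm.sign_sumCongr π π).trans (Int.units_mul_self _)

lemma doublePerm_left {n : ℕ} (π : Equiv.Perm (Fin n)) (j : Fin n) :
    doublePerm π ⟨j.val, by omega⟩ = ⟨(π j).val, by omega⟩ := by
  have hj : (finSumFinEquiv.trans (finCongr (two_mul n).symm)).symm ⟨j.val, by omega⟩ =
      Sum.inl j := by
    rw [Equiv.symm_apply_eq]; ext; simp
  rw [doublePerm, Equiv.permCongr_apply, hj]
  ext; simp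

lemma doublePerm_right {n : ℕ} (π : Equiv.Perm (Fin n)) (j : Fin n) :
    doublePerm π ⟨n + j.val, by omega⟩ = ⟨n + (π j).val, by omega⟩ := by
  have hj : (finSumFinEquiv.trans (finCongr (two_mul n).symm)).symm ⟨n + j.val, by omega⟩ =
      Sum.inr j := by
    rw [Equiv.symm_apply_eq]; ext; simp [add_comm]
  rw [doublePerm, Equiv.permCongr_apply, hj]
  ext; simp [add_comm]

lemma Interleaves.doublePerm_mul {n : ℕ} {ρ0 : Equiv.Perm (Fin (2 * n))}
    (hρ0 : Interleaves n 1 ρ0) (π : Equiv.Perm (Fin n)) :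
    Interleaves n π (doublePerm π * ρ0) := fun i => by
  constructor
  · rw [Equiv.Perm.mul_apply, (hρ0 i).1]
    exact doublePerm_left π i
  · rw [Equiv.Perm.mul_apply, (hρ0 i).2]
    exact doublePerm_right π i

lemma Interleaves.unique {n : ℕ} {π : Equiv.Perm (Fin n)} {σ τ : Equiv.Perm (Fin (2 * n))}
    (hσ : Interleaves n π σ) (hτ : Interleaves n π τ) : σ = τ := by
  refine Equiv.ext fun k => ?_
  obtain ⟨k, hk⟩ := k
  rcases Nat.even_or_odd' k with ⟨i, rfl | rfl⟩
  · exact (hσ ⟨i, by omega⟩).1.trans (hτ ⟨i, by omega⟩).1.symm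
  · exact (hσ ⟨i, by omega⟩).2.trans (hτ ⟨i, by omega⟩).2.symm

lemma Interleaves.injective {n : ℕ} {π π' : Equiv.Perm (Fin n)} {σ : Equiv.Perm (Fin (2 * n))}
    (hσ : Interleaves n π σ) (hσ' : Interleaves n π' σ) : π = π' := by
  refine Equiv.ext fun i => Fin.ext ?_
  simpa using (hσ i).1.symm.trans (hσ' i).1

lemma exists_interleaves {n : ℕ} {σ : Equiv.Perm (Fin (2 * n))}
    (hσ : ∀ i : Fin n, ∃ j : Fin n, σ ⟨2 * i.val, by omega⟩ = ⟨j.val, by omega⟩ ∧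
      σ ⟨2 * i.val + 1, by omega⟩ = ⟨n + j.val, by omega⟩) :
    ∃ π, Interleaves n π σ := by
  choose p hp using hσ
  have hinj : Function.Injective p := fun i i' hii => by
    have := σ.injective ((hp i).1.trans ((by simp [hii] : _ = _).trans (hp i').1.symm))
    simp only [Fin.mk.injEq] at this
    exact Fin.ext (by omega)
  exact ⟨Equiv.ofBijective p (Finite.injective_iff_bijective.mp hinj), hp⟩

lemma exists_fin_left_or_right {n : ℕ} (k : Fin (2 * n)) :
    (∃ j : Fin n, k = ⟨j.val, by omega⟩) ∨ ∃ j : Fin n, k = ⟨n + j.val, by omega⟩ := by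
  by_cases hk : k.val < n
  · exact Or.inl ⟨⟨k, hk⟩, rfl⟩
  · exact Or.inr ⟨⟨k - n, by omega⟩, Fin.ext (by simp; omega)⟩

/-- Let `n = 2^ℓ`, `m = 5ℓ`, and `h_j, h'_j, e ∈ CL_m` with `h_j h'_j = e`, `e` idempotent
and `h_j h'_k = 0` for `j ≠ k`.  For `A ∈ M_n(ℝ)` let `B ∈ M_{2n}(CL_m)` have
`B(2i-1,j) = A(i,j)·h_j` for `j ≤ n`, `B(2i-1,j) = 0` for `j > n`, `B(2i,n+j) = h'_j`,
`B(2i,j) = 0` for `j ≤ n` (1-indexed).  Then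
`Cdet_{2n}(B) = Σ_σ sgn(σ) B(1,σ(1))⋯B(2n,σ(2n)) = sgn(ρ(1_n)) · perm_n(A) · e`. -/
theorem Cdet_clifford_eq_perm (ℓ n m : ℕ) (hn : n = 2 ^ ℓ) (hm : m = 5 * ℓ)
    (h h' : Fin n → (Finset (Fin m) → ℝ)) (e : Finset (Fin m) → ℝ)
    (hhev : ∀ j S, Odd S.card → h j S = 0)
    (hh'ev : ∀ j S, Odd S.card → h' j S = 0)
    (heev : ∀ S, Odd S.card → e S = 0)
    (hprod : ∀ j, clMul (h j) (h' j) = e)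
    (hzero : ∀ j k, j ≠ k → clMul (h j) (h' k) = 0)
    (hidem : clMul e e = e)
    (A : Matrix (Fin n) (Fin n) ℝ)
    (B : Matrix (Fin (2 * n)) (Fin (2 * n)) (Finset (Fin m) → ℝ))
    (hB1 : ∀ (i j : Fin n), B ⟨2 * i.val, by have := i.isLt; omega⟩
        ⟨j.val, by have := j.isLt; omega⟩ = A i j • h j)
    (hB2 : ∀ (i j : Fin n), B ⟨2 * i.val, by have := i.isLt; omega⟩
        ⟨n + j.val, by have := j.isLt; omega⟩ = 0)
    (hB3 : ∀ (i j : Fin n), B ⟨2 * i.val + 1, by have := i.isLt; omega⟩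
        ⟨n + j.val, by have := j.isLt; omega⟩ = h' j)
    (hB4 : ∀ (i j : Fin n), B ⟨2 * i.val + 1, by have := i.isLt; omega⟩
        ⟨j.val, by have := j.isLt; omega⟩ = 0)
    (ρ0 : Equiv.Perm (Fin (2 * n))) (hρ0 : Interleaves n 1 ρ0) :
    ∑ σ : Equiv.Perm (Fin (2 * n)),
        ((Equiv.Perm.sign σ : ℤ) : ℝ) •
          (List.ofFn fun i : Fin (2 * n) => B i (σ i)).foldr clMul clOne =
      (((Equiv.Perm.sign ρ0 : ℤ) : ℝ) *
        ∑ π : Equiv.Perm (Fin n), ∏ i : Fin n, A i (π i)) • e := by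
  have hpos : 0 < n := hn ▸ Nat.two_pow_pos ℓ
  symm
  rw [Finset.mul_sum, Finset.sum_smul]
  refine Fintype.sum_of_injective (fun π => doublePerm π * ρ0) (fun π π' hππ => ?_) _ _
    (fun σ hσ => ?_) (fun π => ?_)
  · refine (hρ0.doublePerm_mul π).injective (π' := π') ?_
    change doublePerm π * ρ0 = doublePerm π' * ρ0 at hππ
    rw [hππ]
    exact hρ0.doublePerm_mul π'
  · rw [foldr_clMul_ofFn_two_mul, foldr_clMul_eq_zero, smul_zero]
    by_contra hmem
    refine hσ ?_
    obtain ⟨π, hπ⟩ : ∃ π, Interleaves n π σ := by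
      refine exists_interleaves fun i => ?_
      have hi : clMul (B ⟨2 * i.val, by omega⟩ (σ ⟨2 * i.val, by omega⟩))
          (B ⟨2 * i.val + 1, by omega⟩ (σ ⟨2 * i.val + 1, by omega⟩)) ≠ 0 :=
        fun h0 => hmem ((List.mem_ofFn' _ _).mpr ⟨i, h0⟩)
      rcases exists_fin_left_or_right (σ ⟨2 * i.val, by omega⟩) with ⟨j, hj⟩ | ⟨j, hj⟩
      · rcases exists_fin_left_or_right (σ ⟨2 * i.val + 1, by omega⟩) with ⟨k, hk⟩ | ⟨k, hk⟩
        · exact (hi (by rw [hk, hB4, clMul_zero])).elim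
        · by_cases hjk : j = k
          · exact ⟨j, hj, hjk ▸ hk⟩
          · exact (hi (by rw [hj, hk, hB1, hB3, smul_clMul, hzero j k hjk, smul_zero])).elim
      · exact (hi (by rw [hj, hB2, zero_clMul])).elim
    exact ⟨π, (hρ0.doublePerm_mul π).unique hπ⟩
  · have hπ := hρ0.doublePerm_mul π
    have hterm : ∀ i : Fin n,
        clMul (B ⟨2 * i.val, by omega⟩ ((doublePerm π * ρ0) ⟨2 * i.val, by omega⟩))
          (B ⟨2 * i.val + 1, by omega⟩ ((doublePerm π * ρ0) ⟨2 * i.val + 1, by omega⟩)) =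
        A i (π i) • e := fun i => by
      rw [(hπ i).1, (hπ i).2, hB1, hB3, smul_clMul, hprod]
    have hfold : (List.ofFn fun i => A i (π i) • e).foldr clMul clOne =
        (∏ i, A i (π i)) • e := by
      obtain ⟨k, rfl⟩ := Nat.exists_eq_add_one.mpr hpos
      have := foldr_clMul_smul_idempotent hidem (A 0 (π 0))
        (List.ofFn fun i : Fin k => A i.succ (π i.succ))
      rw [← List.prod_ofFn, List.ofFn_succ (f := fun i => A i (π i)), ← this, List.ofFn_succ,
        List.map_cons, List.map_ofFn]
      rfl
    rw [foldr_clMul_ofFn_two_mul]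
    simp only [hterm]
    rw [hfold, smul_smul, Equiv.Perm.sign_mul, sign_doublePerm, one_mul]
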